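/- For every A ≥ 1 there exist constants C > 0 and τ₀ ∈ (0,1), depending only on A, such that for all τ ∈ (0, τ₀), every P ∈ S³, and every t with A⁻¹ τ^{−1/2} < t < A τ^{−1/2}, one has ∫_{S³} | δ_{P,t}(x)^{3−τ} − δ_{P,t}(x)³ | dx ≤ C τ |log τ|, i.e., ‖ δ_{P,t}^{3−τ} − δ_{P,t}³ ‖_{L¹(S³)} ≤ C τ |log τ| with respect to the surface measure of S³. -/

import Mathlib

open MeasureTheory Real Set Metric
open scoped RealInnerProductSpace

noncomputable section

/-- The unit sphere `S³ ⊂ ℝ⁴`. -/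
abbrev S3 : Set (EuclideanSpace ℝ (Fin 4)) := Metric.sphere (0 : EuclideanSpace ℝ (Fin 4)) 1

/-- The surface (Riemannian volume) measure on `S³`, realized as the measure on the unit
sphere induced by the Lebesgue measure of `ℝ⁴` (so that the total mass is `2π²`). -/
def μS3 : Measure S3 := (volume : Measure (EuclideanSpace ℝ (Fin 4))).toSphere

/-- The standard bubble `δ_{P,t}(x) = t / (1 + ((t²−1)/2)(1 − ⟨x,P⟩))` on `S³`. -/
def bubble (P : S3) (t : ℝ) (x : S3) : ℝ :=
  t / (1 + ((t ^ 2 - 1) / 2) *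
    (1 - ⟪(x : EuclideanSpace ℝ (Fin 4)), (P : EuclideanSpace ℝ (Fin 4))⟫))

/-- The geodesic distance on the unit sphere: `d(P,Q) = arccos ⟨P,Q⟩`. -/
def geoDist (P Q : S3) : ℝ :=
  Real.arccos ⟪(P : EuclideanSpace ℝ (Fin 4)), (Q : EuclideanSpace ℝ (Fin 4))⟫

/-- The Green's function `G_P(Q) = 1/(1 − ⟨P,Q⟩) = 1/(1 − cos d(P,Q))`. -/
def green (P Q : S3) : ℝ :=
  1 / (1 - ⟪(P : EuclideanSpace ℝ (Fin 4)), (Q : EuclideanSpace ℝ (Fin 4))⟫)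

open scoped ENNReal

/-- A function on the unit sphere that is dominated along rays by a function on the unit ball has
surface integral at most `dim E` times the volume integral of the latter. -/
theorem lintegral_toSphere_le {E : Type*} [NormedAddCommGroup E] [NormedSpace ℝ E]
    [FiniteDimensional ℝ E] [Nontrivial E] [MeasurableSpace E] [BorelSpace E]
    (μ : Measure E) [μ.IsAddHaarMeasure] {g : sphere (0 : E) 1 → ℝ≥0∞} (hg : Measurable g)
    {F : E → ℝ≥0∞} (hF : Measurable F)
    (h : ∀ x : sphere (0 : E) 1, ∀ r ∈ Ioo (0 : ℝ) 1, g x ≤ F (r • (x : E))) :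
    ∫⁻ x, g x ∂μ.toSphere ≤ Module.finrank ℝ E * ∫⁻ y, F y ∂μ := by
  set n := Module.finrank ℝ E
  have hn0 : 0 < n := Module.finrank_pos
  let one : Ioi (0 : ℝ) := ⟨1, mem_Ioi.2 one_pos⟩
  have hvol : Measure.volumeIoiPow (n - 1) (Iio one) = (n : ℝ≥0∞)⁻¹ := by
    rw [Measure.volumeIoiPow_apply_Iio]
    have : ((n - 1 : ℕ) : ℝ) + 1 = n := by exact_mod_cast Nat.sub_add_cancel hn0
    rw [this, one_pow, one_div, ENNReal.ofReal_inv_of_pos (by exact_mod_cast hn0),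
      ENNReal.ofReal_natCast]
  have hpolar : ∫⁻ p, F ((p.2 : ℝ) • (p.1 : E))
      ∂(μ.toSphere.prod (Measure.volumeIoiPow (n - 1))) ≤ ∫⁻ y, F y ∂μ := by
    have hmp := μ.measurePreserving_homeomorphUnitSphereProd
    rw [← hmp.lintegral_comp (f := fun p ↦ F ((p.2 : ℝ) • (p.1 : E)))
      (hF.comp (by fun_prop))]
    calc _ = ∫⁻ y : ({0}ᶜ : Set E), F y ∂μ.comap (↑) := by
          refine lintegral_congr fun y ↦ ?_
          congr 1
          exact congrArg Subtype.val ((homeomorphUnitSphereProd E).symm_apply_apply y)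
      _ = ∫⁻ y in ({0}ᶜ : Set E), F y ∂μ :=
          lintegral_subtype_comap (measurableSet_singleton _).compl _
      _ ≤ _ := setLIntegral_le_lintegral _ _
  have hprod : (∫⁻ x, g x ∂μ.toSphere) * (n : ℝ≥0∞)⁻¹ ≤ ∫⁻ y, F y ∂μ := by
    refine le_trans ?_ hpolar
    rw [← hvol, ← lintegral_indicator_one measurableSet_Iio,
      ← lintegral_prod_mul hg.aemeasurable
        (measurable_one.indicator measurableSet_Iio).aemeasurable]
    refine lintegral_mono fun p ↦ ?_
    by_cases hp : p.2 ∈ Iio one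
    · simpa [hp] using h p.1 p.2 ⟨p.2.2, hp⟩
    · simp [hp]
  calc _ = n * ((∫⁻ x, g x ∂μ.toSphere) * (n : ℝ≥0∞)⁻¹) := by
        rw [mul_comm, mul_assoc, ENNReal.inv_mul_cancel (by simpa using hn0.ne') (by simp), mul_one]
    _ ≤ _ := by gcongr

/-- Every unit vector of `ℝ⁴` is the first axis of an orthonormal system of coordinates. -/
theorem exists_orthonormalBasis_zero_eq (P : S3) :
    ∃ b : OrthonormalBasis (Fin 4) ℝ (EuclideanSpace ℝ (Fin 4)), b 0 = P := by
  obtain ⟨b, hb⟩ := Orthonormal.exists_orthonormalBasis_extension_of_card_eq (𝕜 := ℝ)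
    (E := EuclideanSpace ℝ (Fin 4)) (ι := Fin 4) (by simp) (v := fun _ ↦ P) (s := {0})
    ⟨fun i ↦ by simp, fun i j hij ↦ (hij (Subsingleton.elim i j)).elim⟩
  exact ⟨b, hb 0 rfl⟩

/-- Splitting off the first coordinate with respect to an orthonormal basis preserves volume. -/
theorem measurePreserving_splitFirst
    (b : OrthonormalBasis (Fin 4) ℝ (EuclideanSpace ℝ (Fin 4))) :
    MeasurePreserving
      (fun y ↦ (⟪b 0, y⟫, fun i : Fin 3 ↦ ⟪b i.succ, y⟫) :
        EuclideanSpace ℝ (Fin 4) → ℝ × (Fin 3 → ℝ)) := by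
  have h := (volume_preserving_piFinSuccAbove (fun _ : Fin 4 ↦ ℝ) 0).comp
    ((PiLp.volume_preserving_ofLp (Fin 4)).comp b.measurePreserving_repr)
  refine (congrArg (MeasurePreserving · volume volume) ?_).mpr h
  funext y
  ext i
  · simp [MeasurableEquiv.piFinSuccAbove, Fin.insertNthEquiv, b.repr_apply_apply]
  · simp [MeasurableEquiv.piFinSuccAbove, Fin.insertNthEquiv, b.repr_apply_apply, Fin.tail]

theorem norm_sq_tail_le (b : OrthonormalBasis (Fin 4) ℝ (EuclideanSpace ℝ (Fin 4)))
    (y : EuclideanSpace ℝ (Fin 4)) :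
    ‖fun i : Fin 3 ↦ ⟪b i.succ, y⟫‖ ^ 2 ≤ ‖y‖ ^ 2 - ⟪b 0, y⟫ ^ 2 := by
  have hsum : ‖y‖ ^ 2 - ⟪b 0, y⟫ ^ 2 = ∑ i : Fin 3, ⟪b i.succ, y⟫ ^ 2 := by
    rw [← b.sum_sq_inner_left y, Fin.sum_univ_succ]
    simp [real_inner_comm]
  rw [hsum]
  refine Real.le_sqrt (norm_nonneg _) (by positivity) |>.1 ?_
  rw [pi_norm_le_iff_of_nonneg (Real.sqrt_nonneg _)]
  intro i
  rw [Real.norm_eq_abs, ← Real.sqrt_sq_eq_abs]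
  exact Real.sqrt_le_sqrt
    (Finset.single_le_sum (f := fun i : Fin 3 ↦ ⟪b i.succ, y⟫ ^ 2)
      (fun _ _ ↦ sq_nonneg _) (Finset.mem_univ i))

theorem abs_inner_le_one (x P : S3) :
    |⟪(x : EuclideanSpace ℝ (Fin 4)), (P : EuclideanSpace ℝ (Fin 4))⟫| ≤ 1 := by
  simpa using abs_real_inner_le_norm (x : EuclideanSpace ℝ (Fin 4)) P

theorem one_le_bubble_denom (P x : S3) {t : ℝ} (ht : 1 ≤ t ^ 2) :
    1 ≤ 1 + ((t ^ 2 - 1) / 2) *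
      (1 - ⟪(x : EuclideanSpace ℝ (Fin 4)), (P : EuclideanSpace ℝ (Fin 4))⟫) := by
  have := (abs_le.1 (abs_inner_le_one x P)).2
  nlinarith [mul_nonneg (sub_nonneg.2 ht) (sub_nonneg.2 this)]

theorem bubble_denom_le (P x : S3) {t : ℝ} (ht : 1 ≤ t ^ 2) :
    1 + ((t ^ 2 - 1) / 2) *
      (1 - ⟪(x : EuclideanSpace ℝ (Fin 4)), (P : EuclideanSpace ℝ (Fin 4))⟫) ≤ t ^ 2 := by
  have := (abs_le.1 (abs_inner_le_one x P)).1
  nlinarith [mul_nonneg (sub_nonneg.2 ht) (by linarith :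
    (0 : ℝ) ≤ 1 + ⟪(x : EuclideanSpace ℝ (Fin 4)), (P : EuclideanSpace ℝ (Fin 4))⟫)]

theorem bubble_pos (P x : S3) {t : ℝ} (ht : 1 ≤ t) : 0 < bubble P t x :=
  div_pos (by linarith) (by linarith [one_le_bubble_denom P x (one_le_pow₀ ht (n := 2))])

theorem abs_log_bubble_le (P x : S3) {t : ℝ} (ht : 1 ≤ t) :
    |Real.log (bubble P t x)| ≤ Real.log t := by
  have ht2 : 1 ≤ t ^ 2 := one_le_pow₀ ht
  have h1 := one_le_bubble_denom P x ht2
  have h2 := Real.log_le_log (by linarith) (bubble_denom_le P x ht2)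
  rw [Real.log_pow] at h2
  have h3 := Real.log_nonneg h1
  rw [bubble, Real.log_div (by linarith) (by linarith), abs_le]
  push_cast at h2
  constructor <;> linarith

theorem continuous_bubble (P : S3) {t : ℝ} (ht : 1 ≤ t) : Continuous (bubble P t) := by
  unfold bubble
  refine Continuous.div continuous_const (by fun_prop) fun x ↦ ?_
  linarith [one_le_bubble_denom P x (one_le_pow₀ ht (n := 2))]

theorem integrable_bubble_cube (P : S3) {t : ℝ} (ht : 1 ≤ t) :
    Integrable (fun x ↦ bubble P t x ^ 3) μS3 := by
  rw [μS3]
  exact ((continuous_bubble P ht).pow 3).integrable_of_hasCompactSupport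
    (HasCompactSupport.of_compactSpace _)

/-- Along the ray through `x`, the cube of the bubble is dominated by a rescaled profile in the
coordinates orthogonal to the concentration point. -/
theorem bubble_cube_le (P x : S3) {t r : ℝ} (ht : 0 < t) (ht2 : 2 ≤ t ^ 2) (hr : r ∈ Ioo (0 : ℝ) 1)
    {b : OrthonormalBasis (Fin 4) ℝ (EuclideanSpace ℝ (Fin 4))} (hb : b 0 = P) :
    bubble P t x ^ 3 ≤ 512 * (t ^ 3 *
      (1 + ‖t • fun i : Fin 3 ↦ ⟪b i.succ, r • (x : EuclideanSpace ℝ (Fin 4))⟫‖ ^ 2) ^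
        (-6 / 2 : ℝ)) := by
  have hw := norm_sq_tail_le b (r • (x : EuclideanSpace ℝ (Fin 4)))
  have hx : ‖(x : EuclideanSpace ℝ (Fin 4))‖ = 1 := by simp
  rw [hb, real_inner_comm, real_inner_smul_left, norm_smul, hx, mul_one, Real.norm_eq_abs,
    sq_abs] at hw
  rw [norm_smul, Real.norm_eq_abs, mul_pow, sq_abs]
  set N := ‖fun i : Fin 3 ↦ ⟪b i.succ, r • (x : EuclideanSpace ℝ (Fin 4))⟫‖ ^ 2
  have hN0 : 0 ≤ N := sq_nonneg _
  have hc := abs_le.1 (abs_inner_le_one x P)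
  rw [bubble]
  set c := ⟪(x : EuclideanSpace ℝ (Fin 4)), (P : EuclideanSpace ℝ (Fin 4))⟫
  have hNc : N ≤ 2 * (1 - c) := by
    have : r ^ 2 ≤ 1 := pow_le_one₀ hr.1.le hr.2.le
    nlinarith [mul_nonneg (sub_nonneg.2 this) (by nlinarith : 0 ≤ 1 - c ^ 2), sq_nonneg (1 - c)]
  have hD : (1 + t ^ 2 * N) / 8 ≤ 1 + ((t ^ 2 - 1) / 2) * (1 - c) := by
    nlinarith [mul_nonneg (sub_nonneg.2 ht2) (sub_nonneg.2 hc.2),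
      mul_le_mul_of_nonneg_left hNc (sq_nonneg t)]
  have hpos : 0 < 1 + t ^ 2 * N := by positivity
  have hpow : (1 + t ^ 2 * N) ^ (-6 / 2 : ℝ) = ((1 + t ^ 2 * N) ^ 3)⁻¹ := by
    rw [show (-6 / 2 : ℝ) = -((3 : ℕ) : ℝ) by norm_num, Real.rpow_neg hpos.le, Real.rpow_natCast]
  rw [hpow]
  have hD0 : 0 < 1 + ((t ^ 2 - 1) / 2) * (1 - c) := by linarith
  calc _ ≤ (t / ((1 + t ^ 2 * N) / 8)) ^ 3 := by gcongr
    _ = _ := by field_simp; norm_num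

/-- The profile `(1 + |v|²)⁻³` on `ℝ³`, for the supremum norm, has finite integral. -/
theorem integrable_profile :
    Integrable (fun v : Fin 3 → ℝ ↦ (1 + ‖v‖ ^ 2) ^ (-6 / 2 : ℝ)) :=
  integrable_rpow_neg_one_add_norm_sq (by norm_num)

theorem integral_bubble_cube_le (P : S3) {t : ℝ} (ht : 1 ≤ t) (ht2 : 2 ≤ t ^ 2) :
    ∫ x, bubble P t x ^ 3 ∂μS3 ≤
      4096 * ∫ v : Fin 3 → ℝ, (1 + ‖v‖ ^ 2) ^ (-6 / 2 : ℝ) := by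
  obtain ⟨b, hb⟩ := exists_orthonormalBasis_zero_eq P
  have ht0 : 0 < t := by linarith
  let k : (Fin 3 → ℝ) → ℝ := fun w ↦ 512 * (t ^ 3 * (1 + ‖t • w‖ ^ 2) ^ (-6 / 2 : ℝ))
  have hk0 : ∀ w, 0 ≤ k w := fun w ↦ by positivity
  have hk : Integrable k :=
    ((integrable_profile.comp_smul ht0.ne').const_mul _).const_mul _
  have hkm : Measurable k := by fun_prop
  have hkI : ∫ w, k w = 512 * ∫ v : Fin 3 → ℝ, (1 + ‖v‖ ^ 2) ^ (-6 / 2 : ℝ) := by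
    simp only [k]
    rw [integral_const_mul, integral_const_mul,
      Measure.integral_comp_smul_of_nonneg volume
        (fun v : Fin 3 → ℝ ↦ (1 + ‖v‖ ^ 2) ^ (-6 / 2 : ℝ)) t (hR := ht0.le)]
    simp only [Module.finrank_fintype_fun_eq_card, Fintype.card_fin, smul_eq_mul]
    field_simp
  let G : ℝ × (Fin 3 → ℝ) → ℝ≥0∞ :=
    fun p ↦ (Icc (-1 : ℝ) 1).indicator 1 p.1 * ENNReal.ofReal (k p.2)
  have hG : Measurable G :=
    ((measurable_one.indicator measurableSet_Icc).comp measurable_fst).mul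
      (hkm.ennreal_ofReal.comp measurable_snd)
  have hGI : ∫⁻ p, G p = ENNReal.ofReal (2 * ∫ w, k w) := by
    rw [Measure.volume_eq_prod, lintegral_prod_mul
      (measurable_one.indicator measurableSet_Icc).aemeasurable hkm.ennreal_ofReal.aemeasurable,
      lintegral_indicator_one measurableSet_Icc, Real.volume_Icc,
      ← ofReal_integral_eq_lintegral_ofReal hk (.of_forall hk0),
      ← ENNReal.ofReal_mul (by norm_num)]
    norm_num
  have he := measurePreserving_splitFirst b
  have hcont := continuous_bubble P ht
  have hint := integrable_bubble_cube P ht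
  have key := lintegral_toSphere_le (volume : Measure (EuclideanSpace ℝ (Fin 4)))
    (g := fun x ↦ ENNReal.ofReal (bubble P t x ^ 3))
    (hcont.pow 3).measurable.ennreal_ofReal (hG.comp he.measurable) (fun x r hr ↦ by
      have h1 : ⟪b 0, r • (x : EuclideanSpace ℝ (Fin 4))⟫ ∈ Icc (-1 : ℝ) 1 := by
        rw [hb, real_inner_comm, real_inner_smul_left, mem_Icc, ← abs_le, abs_mul, abs_of_pos hr.1]
        exact mul_le_one₀ hr.2.le (abs_nonneg _) (abs_inner_le_one x P)
      simp only [G, Function.comp, indicator_of_mem h1, Pi.one_apply, one_mul]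
      exact ENNReal.ofReal_le_ofReal (bubble_cube_le P x ht0 ht2 hr hb))
  have h0 : ∀ x, 0 ≤ bubble P t x ^ 3 := fun x ↦ (pow_pos (bubble_pos P x ht) 3).le
  simp only [Function.comp_def] at key
  rw [he.lintegral_comp hG, hGI, ← μS3,
    ← ofReal_integral_eq_lintegral_ofReal hint (.of_forall h0), finrank_euclideanSpace_fin,
    ← ENNReal.ofReal_natCast, ← ENNReal.ofReal_mul (by norm_num), hkI,
    ENNReal.ofReal_le_ofReal_iff (by positivity)] at key
  refine key.trans_eq ?_
  push_cast
  ring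

theorem abs_bubble_rpow_sub_le (P x : S3) {t τ : ℝ} (ht : 1 ≤ t) (hτ : 0 < τ)
    (hτt : τ * Real.log t ≤ 1) :
    |bubble P t x ^ (3 - τ) - bubble P t x ^ 3| ≤ 2 * (τ * Real.log t) * bubble P t x ^ 3 := by
  have hpos := bubble_pos P x ht
  have hlog : |-(τ * Real.log (bubble P t x))| ≤ τ * Real.log t := by
    rw [abs_neg, abs_mul, abs_of_pos hτ]
    exact mul_le_mul_of_nonneg_left (abs_log_bubble_le P x ht) hτ.le
  have hexp := Real.abs_exp_sub_one_le (hlog.trans hτt)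
  have hsplit : bubble P t x ^ (3 - τ) - bubble P t x ^ 3 =
      (Real.exp (-(τ * Real.log (bubble P t x))) - 1) * bubble P t x ^ 3 := by
    rw [sub_eq_add_neg 3 τ, Real.rpow_add hpos, Real.rpow_def_of_pos hpos (-τ)]
    norm_cast
    ring_nf
  rw [hsplit, abs_mul, abs_of_pos (pow_pos hpos 3)]
  gcongr
  linarith

theorem stmt16 (A : ℝ) (hA : 1 ≤ A) :
    ∃ C > 0, ∃ τ₀ ∈ Set.Ioo (0 : ℝ) 1, ∀ τ ∈ Set.Ioo (0 : ℝ) τ₀, ∀ P : S3, ∀ t : ℝ,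
      A⁻¹ * τ ^ (-(1 : ℝ) / 2) < t → t < A * τ ^ (-(1 : ℝ) / 2) →
      (∫ x, |(bubble P t x) ^ ((3 : ℝ) - τ) - (bubble P t x) ^ 3| ∂μS3) ≤
        C * τ * |Real.log τ| := by
  have hA0 : 0 < A := by linarith
  set I := ∫ v : Fin 3 → ℝ, (1 + ‖v‖ ^ 2) ^ (-6 / 2 : ℝ)
  have hI0 : 0 ≤ I := integral_nonneg fun v ↦ by positivity
  refine ⟨8192 * I + 1, by positivity, 1 / (2 * A ^ 2), ⟨by positivity, ?_⟩, ?_⟩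
  · rw [div_lt_one (by positivity)]
    nlinarith
  rintro τ ⟨hτ, hτ0⟩ P t ht1 ht2
  have hτA : τ * (2 * A ^ 2) < 1 := (lt_div_iff₀ (by positivity)).1 hτ0
  have hτ1 : τ < 1 := by nlinarith
  set s := τ ^ (-(1 : ℝ) / 2) with hs
  have hs0 : 0 < s := Real.rpow_pos_of_pos hτ _
  have hs2 : s ^ 2 = τ⁻¹ := by
    rw [hs, ← Real.rpow_natCast, ← Real.rpow_mul hτ.le]
    norm_num [Real.rpow_neg_one]
  have hsA : 2 * A ^ 2 ≤ s ^ 2 := by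
    rw [hs2, ← one_div, le_div_iff₀ hτ]
    linarith
  have ht0 : 0 < t := lt_trans (by positivity) ht1
  have htsq : 2 ≤ t ^ 2 := by
    have h1 : s < t * A := by rwa [inv_mul_eq_div, div_lt_iff₀ hA0] at ht1
    have h2 : s ^ 2 ≤ (t * A) ^ 2 := by gcongr
    have h3 : 2 * A ^ 2 ≤ t ^ 2 * A ^ 2 := by linarith [mul_pow t A 2]
    exact le_of_mul_le_mul_right h3 (by positivity)
  have ht : 1 ≤ t := by nlinarith
  have htτ : t ≤ τ⁻¹ := by
    have hAs : A ≤ s := by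
      refine le_of_sq_le_sq ?_ hs0.le
      nlinarith
    rw [← hs2]
    nlinarith
  have hlog : Real.log t ≤ |Real.log τ| := by
    rw [abs_of_neg (Real.log_neg hτ hτ1), ← Real.log_inv]
    exact Real.log_le_log ht0 htτ
  have hτlog : τ * Real.log t ≤ 1 := by
    have h1 : Real.log t ≤ τ⁻¹ := by linarith [Real.log_le_sub_one_of_pos ht0]
    calc τ * Real.log t ≤ τ * τ⁻¹ := by gcongr
      _ = 1 := mul_inv_cancel₀ hτ.ne'
  have hint := integrable_bubble_cube P ht
  have hlogt : 0 ≤ Real.log t := Real.log_nonneg ht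
  calc _ ≤ ∫ x, 2 * (τ * Real.log t) * bubble P t x ^ 3 ∂μS3 :=
        integral_mono_of_nonneg (.of_forall fun x ↦ abs_nonneg _) (hint.const_mul _)
          (.of_forall fun x ↦ abs_bubble_rpow_sub_le P x ht hτ hτlog)
    _ = 2 * (τ * Real.log t) * ∫ x, bubble P t x ^ 3 ∂μS3 := integral_const_mul _ _
    _ ≤ 2 * (τ * |Real.log τ|) * (4096 * I) := by
        have hint0 : 0 ≤ ∫ x, bubble P t x ^ 3 ∂μS3 :=
          integral_nonneg fun x ↦ (pow_pos (bubble_pos P x ht) 3).le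
        gcongr
        exact integral_bubble_cube_le P ht htsq
    _ ≤ _ := by nlinarith [mul_nonneg hτ.le (abs_nonneg (Real.log τ))]
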